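/- Let u : ℝ × ℝ → ℝ be a smooth function of (x,t) with u_xxx(x,t) ≠ 0 for all (x,t), satisfying the evolution equation u_t = −u_xx³/u_xxx². Define p : ℝ × ℝ → ℝ by p = −u_xx. Then p_x(x,t) ≠ 0 for all (x,t), and p satisfies ∂p/∂t = ∂/∂x ( 2·p³·p_xx/p_x³ − 3·p²/p_x ) at every point (x,t), i.e. the potential variable v with v_x = p solves v_t = 2 v_x³ v_xxx/v_xx³ − 3 v_x²/v_xx. -/

import Mathlib

/-- Partial derivative with respect to the first (space) variable. -/
noncomputable def pdx (f : ℝ × ℝ → ℝ) : ℝ × ℝ → ℝ :=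
  fun p => deriv (fun x => f (x, p.2)) p.1

/-- Partial derivative with respect to the second (time) variable. -/
noncomputable def pdt (f : ℝ × ℝ → ℝ) : ℝ × ℝ → ℝ :=
  fun p => deriv (fun t => f (p.1, t)) p.2

lemma hasDerivAt_comp_prodMk_right {f : ℝ × ℝ → ℝ} (hf : Differentiable ℝ f) (q : ℝ × ℝ) :
    HasDerivAt (fun x => f (x, q.2)) (fderiv ℝ f q (1, 0)) q.1 := by
  have h : HasDerivAt (fun x : ℝ => (x, q.2)) ((1 : ℝ), (0 : ℝ)) q.1 :=
    (hasDerivAt_id q.1).prodMk (hasDerivAt_const q.1 q.2)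
  exact (hf q).hasFDerivAt.comp_hasDerivAt q.1 h

lemma hasDerivAt_comp_prodMk_left {f : ℝ × ℝ → ℝ} (hf : Differentiable ℝ f) (q : ℝ × ℝ) :
    HasDerivAt (fun t => f (q.1, t)) (fderiv ℝ f q (0, 1)) q.2 := by
  have h : HasDerivAt (fun t : ℝ => (q.1, t)) ((0 : ℝ), (1 : ℝ)) q.2 :=
    (hasDerivAt_const q.2 q.1).prodMk (hasDerivAt_id q.2)
  exact (hf q).hasFDerivAt.comp_hasDerivAt q.2 h

lemma pdx_eq_fderiv {f : ℝ × ℝ → ℝ} (hf : Differentiable ℝ f) :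
    pdx f = fun q => fderiv ℝ f q (1, 0) :=
  funext fun q => (hasDerivAt_comp_prodMk_right hf q).deriv

lemma pdt_eq_fderiv {f : ℝ × ℝ → ℝ} (hf : Differentiable ℝ f) :
    pdt f = fun q => fderiv ℝ f q (0, 1) :=
  funext fun q => (hasDerivAt_comp_prodMk_left hf q).deriv

lemma hasDerivAt_pdx {f : ℝ × ℝ → ℝ} (hf : Differentiable ℝ f) (q : ℝ × ℝ) :
    HasDerivAt (fun x => f (x, q.2)) (pdx f q) q.1 :=
  (hasDerivAt_comp_prodMk_right hf q).differentiableAt.hasDerivAt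

lemma contDiff_fderiv_apply {f : ℝ × ℝ → ℝ} (hf : ContDiff ℝ (⊤ : ℕ∞) f) (v : ℝ × ℝ) :
    ContDiff ℝ (⊤ : ℕ∞) (fun q => fderiv ℝ f q v) :=
  (hf.fderiv_right (by simp)).clm_apply contDiff_const

lemma contDiff_pdx {f : ℝ × ℝ → ℝ} (hf : ContDiff ℝ (⊤ : ℕ∞) f) :
    ContDiff ℝ (⊤ : ℕ∞) (pdx f) := by
  rw [pdx_eq_fderiv (hf.differentiable (by simp))]
  exact contDiff_fderiv_apply hf _

lemma contDiff_pdt {f : ℝ × ℝ → ℝ} (hf : ContDiff ℝ (⊤ : ℕ∞) f) :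
    ContDiff ℝ (⊤ : ℕ∞) (pdt f) := by
  rw [pdt_eq_fderiv (hf.differentiable (by simp))]
  exact contDiff_fderiv_apply hf _

lemma pdt_pdx_comm {f : ℝ × ℝ → ℝ} (hf : ContDiff ℝ (⊤ : ℕ∞) f) :
    pdt (pdx f) = pdx (pdt f) := by
  have hd := hf.differentiable (by simp)
  rw [pdt_eq_fderiv ((contDiff_pdx hf).differentiable (by simp)),
    pdx_eq_fderiv ((contDiff_pdt hf).differentiable (by simp)),
    pdx_eq_fderiv hd, pdt_eq_fderiv hd]
  funext q
  have hf' : DifferentiableAt ℝ (fderiv ℝ f) q :=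
    (hf.fderiv_right (m := (⊤ : ℕ∞)) (by simp)).differentiable (by simp) q
  have key : ∀ v w : ℝ × ℝ,
      fderiv ℝ (fun q => fderiv ℝ f q v) q w = fderiv ℝ (fderiv ℝ f) q w v := by
    intro v w
    rw [fderiv_clm_apply hf' (differentiableAt_const v)]
    simp
  rw [key, key]
  have hs : IsSymmSndFDerivAt ℝ f q := by
    refine hf.contDiffAt.isSymmSndFDerivAt ?_
    simp only [minSmoothness_of_isRCLikeNormedField]
    exact WithTop.coe_le_coe.2 (le_top : (2 : ℕ∞) ≤ ⊤)
  exact hs _ _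

lemma pdx_neg (f : ℝ × ℝ → ℝ) : pdx (fun q => -f q) = fun q => -pdx f q := by
  funext q
  exact deriv.fun_neg

lemma pdt_neg (f : ℝ × ℝ → ℝ) : pdt (fun q => -f q) = fun q => -pdt f q := by
  funext q
  exact deriv.fun_neg

/-- Potentialisation of Subcase 1.3a: for a solution of `u_t = −u_xx³/u_xxx²`, the
variable `p = −u_xx` has `p_x ≠ 0` and satisfies the compatibility identity
`p_t = D_x( 2 p³ p_xx/p_x³ − 3 p²/p_x )`, i.e. the potential `v` with `v_x = p`
solves `v_t = 2 v_x³ v_xxx/v_xx³ − 3 v_x²/v_xx`. -/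
theorem potentialisation_subcase13a
    (u : ℝ × ℝ → ℝ) (hu : ContDiff ℝ (⊤ : ℕ∞) u)
    (huxxx : ∀ q : ℝ × ℝ, pdx (pdx (pdx u)) q ≠ 0)
    (heq : ∀ q : ℝ × ℝ, pdt u q = -(pdx (pdx u) q) ^ 3 / (pdx (pdx (pdx u)) q) ^ 2)
    (p : ℝ × ℝ → ℝ)
    (hp : p = fun q => -pdx (pdx u) q)
    (G : ℝ × ℝ → ℝ)
    (hG : G = fun q =>
      2 * (p q) ^ 3 * pdx (pdx p) q / (pdx p q) ^ 3 - 3 * (p q) ^ 2 / pdx p q) :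
    (∀ q : ℝ × ℝ, pdx p q ≠ 0) ∧ (∀ q : ℝ × ℝ, pdt p q = pdx G q) := by
  have hw : ContDiff ℝ (⊤ : ℕ∞) (pdx (pdx u)) := contDiff_pdx (contDiff_pdx hu)
  have hpx : pdx p = fun q => -pdx (pdx (pdx u)) q := by rw [hp, pdx_neg]
  have hpxx : pdx (pdx p) = fun q => -pdx (pdx (pdx (pdx u))) q := by rw [hpx, pdx_neg]
  refine ⟨fun q => by simpa [hpx] using huxxx q, fun q => ?_⟩
  have hflux : G = fun q => -pdx (pdt u) q := by
    funext q
    have h1 := hasDerivAt_pdx (hw.differentiable (by simp)) q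
    have h2 := hasDerivAt_pdx ((contDiff_pdx hw).differentiable (by simp)) q
    have h3 := (h1.pow 3).neg.div (h2.pow 2) (pow_ne_zero 2 (huxxx q))
    have h4 := (congrFun (congrArg pdx (funext heq)) q).trans h3.deriv
    have hne := huxxx q
    rw [hG, h4, hpxx, hpx, hp]
    simp only [Pi.pow_apply, Pi.neg_apply, Prod.mk.eta]
    field_simp
    ring
  rw [hflux, hp, pdt_neg, pdx_neg, pdt_pdx_comm (contDiff_pdx hu), pdt_pdx_comm hu]
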